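/- arXiv:1109.5309 — 4 statements merged into one kernel-verified Lean document; each statement's English description precedes it below -/
import Mathlib

section
/- The set L of Liouville numbers is immeasurable: for every translation invariant Borel measure μ on ℝ, L is either μ-null or not σ-finite for μ. -/
open MeasureTheory Set Filter Metric
open scoped ENNReal Pointwise Topology

/-- `B` is σ-finite for `μ`: `B` is a countable union of measurable sets of finite measure. -/
def SigmaFiniteOn (μ : Measure ℝ) (B : Set ℝ) : Prop :=
  ∃ s : ℕ → Set ℝ, (∀ n, MeasurableSet (s n)) ∧ (∀ n, μ (s n) < ⊤) ∧ B = ⋃ n, s n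

/-- `μ` is a translation invariant Borel measure on `ℝ`. -/
def TransInv (μ : Measure ℝ) : Prop :=
  ∀ (A : Set ℝ), MeasurableSet A → ∀ t : ℝ, μ ((· + t) '' A) = μ A

theorem Liouville.add_ratCast {x : ℝ} (hx : Liouville x) (q : ℚ) : Liouville (x + q) := by
  rw [← forall_liouvilleWith_iff] at hx ⊢
  exact fun p => (hx p).add_rat q

theorem IsCompact.isOpen_setOf_forall_add_mem {K U : Set ℝ} (hK : IsCompact K) (hU : IsOpen U) :
    IsOpen {t : ℝ | ∀ x ∈ K, x + t ∈ U} := by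
  refine isOpen_iff_mem_nhds.2 fun t ht => ?_
  refine hK.eventually_forall_of_forall_eventually fun x hx => ?_
  have : Continuous fun p : ℝ × ℝ => p.2 + p.1 := by fun_prop
  exact this.continuousAt.eventually (hU.mem_nhds (ht x hx))

theorem IsCompact.isGδ_setOf_forall_add_mem {K s : Set ℝ} (hK : IsCompact K) (hs : IsGδ s) :
    IsGδ {t : ℝ | ∀ x ∈ K, x + t ∈ s} := by
  obtain ⟨U, hU, rfl⟩ := isGδ_iff_eq_iInter_nat.1 hs
  have : {t : ℝ | ∀ x ∈ K, x + t ∈ ⋂ n, U n} = ⋂ n, {t : ℝ | ∀ x ∈ K, x + t ∈ U n} := by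
    ext t
    simp only [mem_iInter, mem_ofPred_eq]
    exact ⟨fun h n x hx => h x hx n, fun h x hx n => h n x hx⟩
  rw [this]
  exact .iInter_of_isOpen fun n => hK.isOpen_setOf_forall_add_mem (hU n)

theorem IsCompact.isClosed_setOf_le_measure_preimage_add {K : Set ℝ} (hK : IsCompact K)
    (ν : Measure ℝ) [IsFiniteMeasure ν] (ε : ℝ≥0∞) :
    IsClosed {t : ℝ | ε ≤ ν {x | x + t ∈ K}} := by
  rw [← isOpen_compl_iff, isOpen_iff_mem_nhds]
  intro t ht
  obtain ⟨U, hKU, hU, hUε⟩ := Set.exists_isOpen_lt_of_lt {x | x + t ∈ K} ε (not_le.1 ht)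
  have hmem : ∀ y ∈ K, y + -t ∈ U := fun y hy => hKU (by simpa using hy)
  have hopen := (hK.isOpen_setOf_forall_add_mem hU).preimage continuous_neg
  filter_upwards [hopen.mem_nhds hmem] with r hr
  refine not_le.2 ((measure_mono fun x hx => ?_).trans_lt hUε)
  simpa using hr _ hx

/-- Every σ-finite set is, up to a null set, a countable union of compact subsets. -/
theorem SigmaFiniteOn.exists_isCompact {μ : Measure ℝ} {B : Set ℝ} (h : SigmaFiniteOn μ B) :
    ∃ K : ℕ → Set ℝ, (∀ n, IsCompact (K n)) ∧ (∀ n, K n ⊆ B) ∧ (∀ n, μ (K n) < ⊤) ∧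
      μ (B \ ⋃ n, K n) = 0 := by
  obtain ⟨s, hs, hfin, rfl⟩ := h
  have key : ∀ n k : ℕ, ∃ K ⊆ s n, IsCompact K ∧ μ (s n \ K) < ((k : ℝ≥0∞) + 1)⁻¹ := by
    intro n k
    have : IsFiniteMeasure (μ.restrict (s n)) := ⟨by simpa using hfin n⟩
    obtain ⟨K, hKs, hK, hlt⟩ := (hs n).exists_isCompact_sdiff_lt (μ := μ.restrict (s n))
      (measure_ne_top _ _) (ε := ((k : ℝ≥0∞) + 1)⁻¹) (by simp)
    refine ⟨K, hKs, hK, ?_⟩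
    rwa [Measure.restrict_apply ((hs n).diff hK.measurableSet),
      inter_eq_left.2 sdiff_subset] at hlt
  choose K hKs hK hlt using key
  refine ⟨fun m => K m.unpair.1 m.unpair.2, fun m => hK _ _,
    fun m => (hKs _ _).trans (subset_iUnion s _),
    fun m => (measure_mono (hKs _ _)).trans_lt (hfin _), ?_⟩
  rw [iUnion_sdiff, measure_iUnion_null_iff]
  intro n
  by_contra h0
  obtain ⟨k, hk⟩ := ENNReal.exists_inv_nat_lt h0
  refine absurd ((measure_mono ?_).trans_lt (hlt n k)) (not_lt.2 (le_trans ?_ hk.le))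
  · refine sdiff_subset_sdiff_right fun x hx => mem_iUnion.2 ⟨Nat.pair n k, ?_⟩
    simpa using hx
  · exact ENNReal.inv_le_inv.2 le_self_add

theorem stmt6 :
    ∀ μ : Measure ℝ, TransInv μ →
      μ {x : ℝ | Liouville x} = 0 ∨ ¬ SigmaFiniteOn μ {x : ℝ | Liouville x} := by
  intro μ hμ
  by_contra! hcon
  obtain ⟨hpos, hσ⟩ := hcon
  obtain ⟨K, hK, hKL, hKfin, hnull⟩ := hσ.exists_isCompact
  obtain ⟨m, hm⟩ : ∃ m, μ (K m) ≠ 0 := by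
    by_contra! h0
    refine hpos (measure_mono_null (t := ({x | Liouville x} \ ⋃ n, K n) ∪ ⋃ n, K n) ?_ ?_)
    · rw [sdiff_union_self]
      exact subset_union_left
    · exact measure_union_null hnull (measure_iUnion_null h0)
  have : IsFiniteMeasure (μ.restrict (K m)) := ⟨by simpa using hKfin m⟩
  set T : Set ℝ := {t | ∀ x ∈ K m, x + t ∈ {x : ℝ | Liouville x}}
  have hTG : IsGδ T := (hK m).isGδ_setOf_forall_add_mem IsGδ.setOfPred_liouville
  have hTd : Dense T := Rat.denseRange_cast.mono <| by
    rintro _ ⟨q, rfl⟩ x hx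
    exact (hKL m hx).add_ratCast q
  have hcover : T ⊆ ⋃ p : ℕ × ℕ,
      {t | (p.2 : ℝ≥0∞)⁻¹ ≤ μ.restrict (K m) {x | x + t ∈ K p.1}} := by
    intro t ht
    obtain ⟨n, hn⟩ : ∃ n, μ.restrict (K m) {x | x + t ∈ K n} ≠ 0 := by
      by_contra! h0
      refine hm ?_
      rw [← hμ _ (hK m).measurableSet t]
      refine measure_mono_null (t := ({x | Liouville x} \ ⋃ n, K n) ∪
        ⋃ n, (· + t) '' ({x | x + t ∈ K n} ∩ K m)) ?_ ?_
      · rintro _ ⟨x, hx, rfl⟩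
        by_cases h : x + t ∈ ⋃ n, K n
        · obtain ⟨n, hn⟩ := mem_iUnion.1 h
          exact Or.inr (mem_iUnion.2 ⟨n, x, ⟨hn, hx⟩, rfl⟩)
        · exact Or.inl ⟨ht x hx, h⟩
      · refine measure_union_null hnull (measure_iUnion_null fun n => ?_)
        have hmeas : MeasurableSet {x | x + t ∈ K n} :=
          (hK n).measurableSet.preimage (measurable_add_const t)
        rw [hμ _ (hmeas.inter (hK m).measurableSet), ← Measure.restrict_apply hmeas]
        exact h0 n
    obtain ⟨k, hk⟩ := ENNReal.exists_inv_nat_lt hn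
    exact mem_iUnion.2 ⟨(n, k), hk.le⟩
  have hdense := hTG.dense_iUnion_interior_of_closed hTd
    (fun p : ℕ × ℕ => (hK p.1).isClosed_setOf_le_measure_preimage_add _ _) hcover
  obtain ⟨t₀, ht₀⟩ := hdense.nonempty
  obtain ⟨p, hp⟩ := mem_iUnion.1 ht₀
  have hL : MeasurableSet {x : ℝ | Liouville x} := IsGδ.setOfPred_liouville.measurableSet
  have hae : ∀ᵐ t ∂(volume : Measure ℝ), ∀ᵐ x ∂(μ.restrict (K m)), ¬ Liouville (x + t) := by
    rw [Measure.ae_ae_comm]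
    · refine .of_forall fun x => ?_
      exact (measurePreserving_add_left volume x).quasiMeasurePreserving.ae ae_not_liouville
    · exact (hL.preimage (measurable_snd.add measurable_fst)).compl
  obtain ⟨t, htp, ht⟩ : ∃ t ∈ interior {t | (p.2 : ℝ≥0∞)⁻¹ ≤ μ.restrict (K m) {x | x + t ∈ K p.1}},
      ∀ᵐ x ∂(μ.restrict (K m)), ¬ Liouville (x + t) := by
    exact (Measure.dense_of_ae hae).inter_open_nonempty _ isOpen_interior ⟨t₀, hp⟩
  have h0 : μ.restrict (K m) {x | x + t ∈ K p.1} = 0 :=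
    measure_mono_null (fun x hx => not_not.2 (hKL _ hx)) (ae_iff.1 ht)
  have := interior_subset htp
  rw [mem_ofPred_eq, h0] at this
  simp at this
end

section
/- The set G = {x ∈ ℝ : d_n = d_{n+1} for all n outside a set of density zero}, where 0.d₁d₂… is the binary expansion of the fractional part of x (choosing the expansion with finitely many nonzero digits when ambiguous), is a Borel additive subgroup of ℝ that is not F_σ. -/
open MeasureTheory Set Filter Metric
open scoped ENNReal Pointwise Topology

/-- The `i`-th binary digit (`i ≥ 1`) of the fractional part of `x`
(this picks the expansion with finitely many nonzero digits when ambiguous). -/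
noncomputable def binDigit (x : ℝ) (i : ℕ) : ℤ := ⌊Int.fract x * 2 ^ i⌋ % 2

/-- The Besicovitch–Eggleston class `BE(1,0)`: reals whose binary digits
contain `1`'s only on a set of density zero. -/
def BE10 : Set ℝ :=
  {x : ℝ | Tendsto
    (fun n : ℕ => (((Finset.Icc 1 n).filter (fun i => binDigit x i = 1)).card : ℝ) / n)
    atTop (𝓝 0)}

/-- The set of reals whose binary digits satisfy `d_n = d_{n+1}` for all `n`
outside a set of density zero. -/
def GSet : Set ℝ :=
  {x : ℝ | Tendsto
    (fun n : ℕ => (((Finset.Icc 1 n).filter (fun i => binDigit x i ≠ binDigit x (i + 1))).card : ℝ) / n)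
    atTop (𝓝 0)}

/-- The sum of the distances from `2 ^ i * x` to the nearest integer, over `i < n`. -/
noncomputable def dyadicDistSum (n : ℕ) (x : ℝ) : ℝ :=
  ∑ i ∈ Finset.range n, ‖((2 ^ i * x : ℝ) : UnitAddCircle)‖

lemma dyadicDistSum_nonneg (n : ℕ) (x : ℝ) : 0 ≤ dyadicDistSum n x :=
  Finset.sum_nonneg fun _ _ => norm_nonneg _

lemma dyadicDistSum_add_le (n : ℕ) (x y : ℝ) :
    dyadicDistSum n (x + y) ≤ dyadicDistSum n x + dyadicDistSum n y := by
  unfold dyadicDistSum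
  rw [← Finset.sum_add_distrib]
  refine Finset.sum_le_sum fun i _ => ?_
  rw [mul_add, AddCircle.coe_add]
  exact norm_add_le _ _

lemma dyadicDistSum_neg (n : ℕ) (x : ℝ) : dyadicDistSum n (-x) = dyadicDistSum n x := by
  simp [dyadicDistSum]

@[simp]
lemma dyadicDistSum_zero_right (n : ℕ) : dyadicDistSum n 0 = 0 := by
  simp [dyadicDistSum]

lemma continuous_dyadicDistSum (n : ℕ) : Continuous (dyadicDistSum n) :=
  continuous_finsetSum _ fun _ _ =>
    ((AddCircle.continuous_mk' (1 : ℝ)).comp (continuous_const.mul continuous_id)).norm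

lemma dyadicDistSum_add_left (p n : ℕ) (x : ℝ) :
    dyadicDistSum (p + n) x = dyadicDistSum p x + dyadicDistSum n (2 ^ p * x) := by
  unfold dyadicDistSum
  rw [Finset.sum_range_add]
  congr 1
  refine Finset.sum_congr rfl fun i _ => ?_
  rw [pow_add, mul_comm (2 ^ p : ℝ), mul_assoc]

lemma dyadicDistSum_one_add (n : ℕ) (x : ℝ) : dyadicDistSum n (1 + x) = dyadicDistSum n x := by
  unfold dyadicDistSum
  refine Finset.sum_congr rfl fun i _ => ?_
  have h : ((2 ^ i : ℝ) : UnitAddCircle) = 0 := by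
    rw [AddCircle.coe_eq_zero_iff]
    exact ⟨2 ^ i, by simp⟩
  rw [mul_add, mul_one, AddCircle.coe_add, h, zero_add]

lemma norm_coe_unitAddCircle_eq_min (t : ℝ) :
    ‖(t : UnitAddCircle)‖ = min (Int.fract t) (1 - Int.fract t) := by
  rw [UnitAddCircle.norm_eq, abs_sub_round_eq_min]

lemma norm_coe_unitAddCircle_le_abs (t : ℝ) : ‖(t : UnitAddCircle)‖ ≤ |t| := by
  rw [UnitAddCircle.norm_eq]
  simpa using round_le t 0

lemma dyadicDistSum_le {x : ℝ} (hx : 0 ≤ x) (n : ℕ) : dyadicDistSum n x ≤ (2 ^ n - 1) * x := by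
  have h : ∑ i ∈ Finset.range n, (2 : ℝ) ^ i = 2 ^ n - 1 := by
    rw [geom_sum_eq (by norm_num)]
    norm_num
  rw [← h, Finset.sum_mul]
  refine Finset.sum_le_sum fun i _ => (norm_coe_unitAddCircle_le_abs _).trans_eq ?_
  exact abs_of_nonneg (by positivity)

lemma binDigit_eq_floor_fract (x : ℝ) (j k : ℕ) :
    binDigit x (j + (k + 1)) = ⌊Int.fract (2 ^ j * x) * 2 ^ (k + 1)⌋ % 2 := by
  unfold binDigit
  obtain ⟨m, hm⟩ : ∃ m : ℤ, 2 ^ j * Int.fract x = Int.fract (2 ^ j * x) + m := by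
    refine ⟨⌊2 ^ j * x⌋ - 2 ^ j * ⌊x⌋, ?_⟩
    unfold Int.fract
    push_cast
    ring
  have h : Int.fract x * 2 ^ (j + (k + 1)) =
      Int.fract (2 ^ j * x) * 2 ^ (k + 1) + ((2 * (m * 2 ^ k) : ℤ) : ℝ) := by
    push_cast
    linear_combination 2 ^ (k + 1) * hm
  rw [h, Int.floor_add_intCast, Int.add_mul_emod_self_left]

lemma binDigit_ne_succ_iff (x : ℝ) (j : ℕ) :
    binDigit x (j + 1) ≠ binDigit x (j + 1 + 1) ↔
      1 / 4 ≤ Int.fract (2 ^ j * x) ∧ Int.fract (2 ^ j * x) < 3 / 4 := by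
  have h1 := binDigit_eq_floor_fract x j 0
  have h2 := binDigit_eq_floor_fract x j 1
  rw [zero_add] at h1
  rw [add_assoc, h1, h2]
  have h0 := Int.fract_nonneg (2 ^ j * x)
  have h3 := Int.fract_lt_one (2 ^ j * x)
  set f := Int.fract (2 ^ j * x)
  norm_num
  rcases lt_or_ge f (1 / 4) with h | h
  · have e1 : ⌊f * 2⌋ = 0 := by rw [Int.floor_eq_iff]; constructor <;> push_cast <;> linarith
    have e2 : ⌊f * 4⌋ = 0 := by rw [Int.floor_eq_iff]; constructor <;> push_cast <;> linarith
    simp [e1, e2]; intros; linarith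
  rcases lt_or_ge f (1 / 2) with h' | h'
  · have e1 : ⌊f * 2⌋ = 0 := by rw [Int.floor_eq_iff]; constructor <;> push_cast <;> linarith
    have e2 : ⌊f * 4⌋ = 1 := by rw [Int.floor_eq_iff]; constructor <;> push_cast <;> linarith
    simp [e1, e2]; constructor <;> linarith
  rcases lt_or_ge f (3 / 4) with h'' | h''
  · have e1 : ⌊f * 2⌋ = 1 := by rw [Int.floor_eq_iff]; constructor <;> push_cast <;> linarith
    have e2 : ⌊f * 4⌋ = 2 := by rw [Int.floor_eq_iff]; constructor <;> push_cast <;> linarith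
    simp [e1, e2]; constructor <;> linarith
  · have e1 : ⌊f * 2⌋ = 1 := by rw [Int.floor_eq_iff]; constructor <;> push_cast <;> linarith
    have e2 : ⌊f * 4⌋ = 3 := by rw [Int.floor_eq_iff]; constructor <;> push_cast <;> linarith
    simp [e1, e2]; intros; linarith

lemma one_fourth_le_norm_of_binDigit_ne {x : ℝ} {j : ℕ}
    (h : binDigit x (j + 1) ≠ binDigit x (j + 1 + 1)) :
    1 / 4 ≤ ‖((2 ^ j * x : ℝ) : UnitAddCircle)‖ := by
  rw [binDigit_ne_succ_iff] at h
  rw [norm_coe_unitAddCircle_eq_min]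
  exact le_min h.1 (by linarith [h.2])

lemma two_mul_norm_le_of_binDigit_eq {x : ℝ} {j : ℕ}
    (h : binDigit x (j + 1) = binDigit x (j + 1 + 1)) :
    2 * ‖((2 ^ j * x : ℝ) : UnitAddCircle)‖ ≤ ‖((2 ^ (j + 1) * x : ℝ) : UnitAddCircle)‖ := by
  have h' := (binDigit_ne_succ_iff x j).not.1 (not_not.2 h)
  rw [not_and_or, not_le, not_lt] at h'
  rw [norm_coe_unitAddCircle_eq_min, norm_coe_unitAddCircle_eq_min]
  have h0 := Int.fract_nonneg (2 ^ j * x)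
  have h1 := Int.fract_lt_one (2 ^ j * x)
  have hf := Int.floor_add_fract (2 ^ j * x)
  set f := Int.fract (2 ^ j * x)
  rcases h' with h' | h'
  · have : Int.fract (2 ^ (j + 1) * x) = 2 * f := by
      rw [Int.fract_eq_iff]
      refine ⟨by linarith, by linarith, 2 * ⌊2 ^ j * x⌋, ?_⟩
      push_cast
      linear_combination -2 * hf
    rw [this, min_eq_left (by linarith), min_eq_left (by linarith)]
  · have : Int.fract (2 ^ (j + 1) * x) = 2 * f - 1 := by
      rw [Int.fract_eq_iff]
      refine ⟨by linarith, by linarith, 2 * ⌊2 ^ j * x⌋ + 1, ?_⟩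
      push_cast
      linear_combination -2 * hf
    rw [this, min_eq_right (by linarith), min_eq_right (by linarith)]
    linarith

lemma norm_coe_unitAddCircle_le_half (t : ℝ) : ‖(t : UnitAddCircle)‖ ≤ 1 / 2 := by
  rw [UnitAddCircle.norm_eq]
  exact abs_sub_round t

lemma card_binDigit_ne_eq_sum (x : ℝ) (n : ℕ) :
    (((Finset.Icc 1 n).filter (fun i => binDigit x i ≠ binDigit x (i + 1))).card : ℝ) =
      ∑ j ∈ Finset.range n, if binDigit x (j + 1) ≠ binDigit x (j + 1 + 1) then 1 else 0 := by
  rw [Finset.card_filter, Nat.cast_sum, ← Finset.Ico_add_one_right_eq_Icc,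
    Finset.sum_Ico_eq_sum_range]
  simp [add_comm]

lemma card_binDigit_ne_le (x : ℝ) (n : ℕ) :
    (((Finset.Icc 1 n).filter (fun i => binDigit x i ≠ binDigit x (i + 1))).card : ℝ) ≤
      4 * dyadicDistSum n x := by
  rw [card_binDigit_ne_eq_sum, dyadicDistSum, Finset.mul_sum]
  refine Finset.sum_le_sum fun j _ => ?_
  split_ifs with h
  · linarith [one_fourth_le_norm_of_binDigit_ne h]
  · positivity

lemma dyadicDistSum_le_card_binDigit_ne (x : ℝ) (n : ℕ) :
    dyadicDistSum n x ≤
      ((Finset.Icc 1 n).filter (fun i => binDigit x i ≠ binDigit x (i + 1))).card + 1 := by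
  have h : 2 * dyadicDistSum n x ≤ dyadicDistSum n x +
      (‖((2 ^ n * x : ℝ) : UnitAddCircle)‖ - ‖((2 ^ 0 * x : ℝ) : UnitAddCircle)‖) +
      ((Finset.Icc 1 n).filter (fun i => binDigit x i ≠ binDigit x (i + 1))).card := by
    rw [card_binDigit_ne_eq_sum, ← Finset.sum_range_sub
      (fun i => ‖((2 ^ i * x : ℝ) : UnitAddCircle)‖), dyadicDistSum, Finset.mul_sum,
      ← Finset.sum_add_distrib, ← Finset.sum_add_distrib]
    refine Finset.sum_le_sum fun j _ => ?_
    split_ifs with h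
    · linarith [norm_coe_unitAddCircle_le_half (2 ^ j * x),
        norm_nonneg ((2 ^ (j + 1) * x : ℝ) : UnitAddCircle)]
    · linarith [two_mul_norm_le_of_binDigit_eq (not_not.1 h)]
  linarith [norm_coe_unitAddCircle_le_half (2 ^ n * x),
    norm_nonneg ((2 ^ 0 * x : ℝ) : UnitAddCircle)]

lemma mem_GSet_iff {x : ℝ} :
    x ∈ GSet ↔ Tendsto (fun n : ℕ => dyadicDistSum n x / n) atTop (𝓝 0) := by
  constructor
  · intro h
    have h' := Tendsto.add h tendsto_one_div_atTop_nhds_zero_nat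
    rw [add_zero] at h'
    refine squeeze_zero (fun n => div_nonneg (dyadicDistSum_nonneg n x) n.cast_nonneg)
      (fun n => ?_) h'
    rw [← add_div]
    gcongr
    exact dyadicDistSum_le_card_binDigit_ne x n
  · intro h
    have h' := h.const_mul 4
    rw [mul_zero] at h'
    refine squeeze_zero (fun n => by positivity) (fun n => ?_) h'
    rw [← mul_div_assoc]
    gcongr
    exact card_binDigit_ne_le x n

lemma measurableSet_GSet : MeasurableSet GSet := by
  have h : GSet = {x | Tendsto (fun n : ℕ => dyadicDistSum n x / n) atTop (𝓝 0)} :=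
    Set.ext fun _ => mem_GSet_iff
  rw [h]
  exact measurableSet_tendsto _ fun n => ((continuous_dyadicDistSum n).div_const _).measurable

lemma zero_mem_GSet : (0 : ℝ) ∈ GSet := by
  simp [mem_GSet_iff]

lemma add_mem_GSet {x y : ℝ} (hx : x ∈ GSet) (hy : y ∈ GSet) : x + y ∈ GSet := by
  rw [mem_GSet_iff] at *
  have h := hx.add hy
  rw [add_zero] at h
  refine squeeze_zero (fun n => div_nonneg (dyadicDistSum_nonneg n _) n.cast_nonneg)
    (fun n => ?_) h
  rw [← add_div]
  gcongr
  exact dyadicDistSum_add_le n x y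

lemma neg_mem_GSet {x : ℝ} (hx : x ∈ GSet) : -x ∈ GSet := by
  simpa only [mem_GSet_iff, dyadicDistSum_neg] using hx

lemma mem_GSet_of_two_pow_mul {p : ℕ} {x : ℝ} (h : 2 ^ p * x ∈ GSet) : x ∈ GSet := by
  rw [mem_GSet_iff] at *
  have h' := Tendsto.add (tendsto_const_div_atTop_nhds_zero_nat (dyadicDistSum p x)) h
  rw [add_zero] at h'
  refine squeeze_zero (fun n => div_nonneg (dyadicDistSum_nonneg n _) n.cast_nonneg)
    (fun n => ?_) h'
  rw [← add_div, ← dyadicDistSum_add_left]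
  gcongr
  exact Finset.sum_le_sum_of_subset_of_nonneg (Finset.range_subset_range.2 (by omega))
    fun _ _ _ => norm_nonneg _

lemma one_add_mem_GSet {x : ℝ} (hx : x ∈ GSet) : 1 + x ∈ GSet := by
  simpa only [mem_GSet_iff, dyadicDistSum_one_add] using hx

/-- The number whose binary expansion has digits `1` exactly at `p, 2p, …, mp`. -/
noncomputable def sparseDyadic (p m : ℕ) : ℝ := (1 - (1 / 2 ^ p) ^ m) / (2 ^ p - 1)

lemma two_pow_sub_one_pos {p : ℕ} (hp : 1 ≤ p) : (0 : ℝ) < 2 ^ p - 1 := by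
  have := one_lt_pow₀ (one_lt_two : (1 : ℝ) < 2) (by omega : p ≠ 0)
  linarith

lemma two_pow_mul_sparseDyadic_succ {p : ℕ} (hp : 1 ≤ p) (m : ℕ) :
    2 ^ p * sparseDyadic p (m + 1) = 1 + sparseDyadic p m := by
  have := (two_pow_sub_one_pos hp).ne'
  unfold sparseDyadic
  rw [pow_succ]
  field_simp
  ring

@[simp]
lemma sparseDyadic_zero (p : ℕ) : sparseDyadic p 0 = 0 := by
  simp [sparseDyadic]

lemma sparseDyadic_nonneg (p m : ℕ) : 0 ≤ sparseDyadic p m := by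
  have h : (1 : ℝ) ≤ 2 ^ p := one_le_pow₀ one_le_two
  refine div_nonneg (sub_nonneg.2 (pow_le_one₀ (by positivity) ?_)) (sub_nonneg.2 h)
  exact (div_le_one (by positivity)).2 h

lemma sparseDyadic_le {p : ℕ} (hp : 1 ≤ p) (m : ℕ) : sparseDyadic p m ≤ 1 / (2 ^ p - 1) := by
  have := two_pow_sub_one_pos hp
  unfold sparseDyadic
  gcongr
  have : (0 : ℝ) ≤ (1 / 2 ^ p) ^ m := by positivity
  linarith

lemma sparseDyadic_mem_GSet {p : ℕ} (hp : 1 ≤ p) (m : ℕ) : sparseDyadic p m ∈ GSet := by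
  induction m with
  | zero => simpa using zero_mem_GSet
  | succ m ih =>
    apply mem_GSet_of_two_pow_mul (p := p)
    rw [two_pow_mul_sparseDyadic_succ hp]
    exact one_add_mem_GSet ih

lemma mul_two_pow_sub_one_le {n p : ℕ} (h : n ≤ p) :
    (p : ℝ) * (2 ^ n - 1) ≤ n * (2 ^ p - 1) := by
  induction p, h using Nat.le_induction with
  | base => rfl
  | succ p h ih =>
    rcases Nat.eq_zero_or_pos n with rfl | hn
    · simp
    have h1 : (1 : ℝ) ≤ n := by exact_mod_cast hn
    have h2 : (2 : ℝ) ^ n ≤ 2 ^ p := pow_le_pow_right₀ one_le_two h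
    have h3 : (2 : ℝ) ^ p ≤ n * 2 ^ p := le_mul_of_one_le_left (by positivity) h1
    push_cast
    rw [pow_succ]
    linarith

lemma dyadicDistSum_sparseDyadic_le {p : ℕ} (hp : 1 ≤ p) (n m : ℕ) :
    dyadicDistSum n (sparseDyadic p m) ≤ n / p := by
  have hp0 : (0 : ℝ) < p := by exact_mod_cast hp
  have hpos := two_pow_sub_one_pos hp
  have small : ∀ n ≤ p, ∀ m, dyadicDistSum n (sparseDyadic p m) ≤ n / p := by
    intro n hn m
    refine (dyadicDistSum_le (sparseDyadic_nonneg p m) n).trans ?_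
    have h1 : (0 : ℝ) ≤ 2 ^ n - 1 := sub_nonneg.2 (one_le_pow₀ one_le_two)
    refine (mul_le_mul_of_nonneg_left (sparseDyadic_le hp m) h1).trans ?_
    rw [mul_one_div, div_le_div_iff₀ hpos hp0, mul_comm]
    exact mul_two_pow_sub_one_le hn
  induction m generalizing n with
  | zero =>
    simp only [sparseDyadic_zero, dyadicDistSum_zero_right]
    positivity
  | succ m ih =>
    rcases le_total n p with h | h
    · exact small n h _
    · obtain ⟨k, rfl⟩ := Nat.exists_eq_add_of_le h
      rw [dyadicDistSum_add_left, two_pow_mul_sparseDyadic_succ hp, dyadicDistSum_one_add]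
      push_cast
      rw [add_div]
      exact add_le_add (small p le_rfl _) (ih k)

lemma tendsto_sparseDyadic {p : ℕ} (hp : 1 ≤ p) :
    Tendsto (sparseDyadic p) atTop (𝓝 (1 / (2 ^ p - 1))) := by
  have h1 : (1 : ℝ) < 2 ^ p := by linarith [two_pow_sub_one_pos hp]
  have h := tendsto_pow_atTop_nhds_zero_of_lt_one (r := 1 / (2 : ℝ) ^ p) (by positivity)
    ((div_lt_one (by positivity)).2 h1)
  have h' := (h.const_sub 1).div_const (2 ^ p - 1)
  rwa [sub_zero] at h'

lemma one_div_two_pow_sub_one_notMem_GSet {p : ℕ} (hp : 2 ≤ p) :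
    (1 / (2 ^ p - 1) : ℝ) ∉ GSet := by
  have hpos := two_pow_sub_one_pos (p := p) (by omega)
  have h4 : (4 : ℝ) ≤ 2 ^ p := by
    have := pow_le_pow_right₀ (one_le_two : (1 : ℝ) ≤ 2) hp
    norm_num at this
    exact this
  set w : ℝ := 1 / (2 ^ p - 1) with hw
  have hw0 : 0 < w := by positivity
  have hw1 : w ≤ 1 / 3 := one_div_le_one_div_of_le (by norm_num) (by linarith)
  have hper : 2 ^ p * w = 1 + w := by
    rw [hw]
    field_simp
    ring
  have hsum : ∀ k : ℕ, dyadicDistSum (k * p) w = k * dyadicDistSum p w := by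
    intro k
    induction k with
    | zero => simp [dyadicDistSum]
    | succ k ih =>
      rw [Nat.succ_mul, add_comm, dyadicDistSum_add_left, hper, dyadicDistSum_one_add, ih]
      push_cast
      ring
  have hS : w ≤ dyadicDistSum p w := by
    have h := Finset.single_le_sum (f := fun i => ‖((2 ^ i * w : ℝ) : UnitAddCircle)‖)
      (fun _ _ => norm_nonneg _) (Finset.mem_range.2 (by omega : 0 < p))
    refine le_trans ?_ h
    simp only [pow_zero, one_mul]
    rw [norm_coe_unitAddCircle_eq_min, Int.fract_eq_self.2 ⟨hw0.le, by linarith⟩]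
    exact le_min le_rfl (by linarith)
  intro hmem
  rw [mem_GSet_iff] at hmem
  have hlim := hmem.comp (tendsto_id.atTop_mul_const' (by omega : 0 < p))
  have hconst : Tendsto (fun _ : ℕ => dyadicDistSum p w / p) atTop (𝓝 0) := by
    refine hlim.congr' ?_
    filter_upwards [eventually_gt_atTop 0] with k hk
    have hk' : (k : ℝ) ≠ 0 := by exact_mod_cast hk.ne'
    simp only [Function.comp, id]
    rw [hsum, Nat.cast_mul, mul_div_mul_left _ _ hk']
  have h0 := tendsto_nhds_unique tendsto_const_nhds hconst
  have hp0 : (0 : ℝ) < p := by exact_mod_cast (by omega : 0 < p)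
  have : 0 < dyadicDistSum p w / p := div_pos (hw0.trans_le hS) hp0
  exact this.ne' h0

lemma exists_closedBall_disjoint_of_mem_GSet {K : Set ℝ} (hK : IsClosed K) (hKG : K ⊆ GSet)
    {x r ε : ℝ} (hx : x ∈ GSet) (hr : 0 < r) (hε : 0 < ε) :
    ∃ y ∈ GSet, ∃ s > 0, closedBall y s ⊆ closedBall x r ∧ Disjoint (closedBall y s) K ∧
      dist x y ≤ ε ∧ ∀ n : ℕ, dyadicDistSum n (y - x) ≤ ε * n := by
  obtain ⟨q, hq⟩ := exists_nat_gt (1 / min ε (r / 2))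
  set p := q + 2
  have hm : 0 < min ε (r / 2) := by positivity
  have hp0 : (0 : ℝ) < p := by positivity
  have hp : 1 / (p : ℝ) ≤ min ε (r / 2) := by
    rw [div_le_comm₀ hp0 hm]
    refine hq.le.trans ?_
    exact_mod_cast (by omega : q ≤ p)
  have hp1 : 1 ≤ p := by omega
  have hw : x + 1 / (2 ^ p - 1) ∉ K := fun h =>
    one_div_two_pow_sub_one_notMem_GSet (by omega : 2 ≤ p) <| by
      simpa using add_mem_GSet (neg_mem_GSet hx) (hKG h)
  obtain ⟨m, hm'⟩ := (((tendsto_sparseDyadic hp1).const_add x).eventually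
    (hK.isOpen_compl.mem_nhds hw)).exists
  obtain ⟨s, hs, hsK⟩ := nhds_basis_closedBall.mem_iff.1 (hK.isOpen_compl.mem_nhds hm')
  have hd : sparseDyadic p m ≤ 1 / p := by
    refine (sparseDyadic_le hp1 m).trans (one_div_le_one_div_of_le hp0 ?_)
    have := mul_two_pow_sub_one_le hp1
    norm_num at this
    linarith
  have hdist : dist x (x + sparseDyadic p m) ≤ min ε (r / 2) := by
    rw [dist_self_add_right, Real.norm_of_nonneg (sparseDyadic_nonneg p m)]
    exact hd.trans hp
  refine ⟨x + sparseDyadic p m, add_mem_GSet hx (sparseDyadic_mem_GSet hp1 m), min s (r / 2),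
    by positivity, ?_, ?_, hdist.trans (min_le_left _ _), fun n => ?_⟩
  · refine closedBall_subset_closedBall' ?_
    rw [dist_comm]
    linarith [hdist.trans (min_le_right _ _), min_le_right s (r / 2)]
  · rw [disjoint_left]
    exact fun z hz => hsK (closedBall_subset_closedBall (min_le_left _ _) hz)
  · rw [add_sub_cancel_left]
    refine (dyadicDistSum_sparseDyadic_le hp1 n m).trans ?_
    rw [div_eq_mul_one_div, mul_comm]
    gcongr
    exact hp.trans (min_le_left _ _)

lemma exists_mem_GSet_forall_notMem {F : ℕ → Set ℝ} (hF : ∀ k, IsClosed (F k))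
    (hFG : ∀ k, F k ⊆ GSet) : ∃ x ∈ GSet, ∀ k, x ∉ F k := by
  let State := {a : ℝ × ℝ // a.1 ∈ GSet ∧ 0 < a.2}
  have step : ∀ (k : ℕ) (a : State), ∃ b : State,
      closedBall b.1.1 b.1.2 ⊆ closedBall a.1.1 a.1.2 ∧ Disjoint (closedBall b.1.1 b.1.2) (F k) ∧
      dist a.1.1 b.1.1 ≤ 1 / 2 / 2 ^ k ∧
      ∀ n : ℕ, dyadicDistSum n (b.1.1 - a.1.1) ≤ 1 / 2 / 2 ^ k * n := by
    rintro k ⟨⟨x, r⟩, hx, hr⟩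
    obtain ⟨y, hy, s, hs, h⟩ := exists_closedBall_disjoint_of_mem_GSet (hF k) (hFG k) hx hr
      (by positivity : (0 : ℝ) < 1 / 2 / 2 ^ k)
    exact ⟨⟨(y, s), hy, hs⟩, h⟩
  choose next hball hdisj hdist hsum using step
  let a : ℕ → State := fun k => Nat.rec ⟨(0, 1), zero_mem_GSet, one_pos⟩ next k
  let c : ℕ → ℝ := fun k => (a k).1.1
  have hanti : Antitone fun k => closedBall (a k).1.1 (a k).1.2 :=
    antitone_nat_of_succ_le fun k => hball k (a k)
  obtain ⟨x, hx⟩ := cauchySeq_tendsto_of_complete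
    (cauchySeq_of_le_geometric_two (C := 1) (f := c) fun k => hdist k (a k))
  have hxball : ∀ k, x ∈ closedBall (a k).1.1 (a k).1.2 := fun k =>
    isClosed_closedBall.mem_of_tendsto hx <| (eventually_ge_atTop k).mono fun j hj =>
      hanti hj (mem_closedBall_self (a j).2.2.le)
  refine ⟨x, ?_, fun k => disjoint_left.1 (hdisj k (a k)) (hxball (k + 1))⟩
  have htail : ∀ k i n : ℕ,
      dyadicDistSum n (c (k + i) - c k) ≤ (1 / 2 ^ k - 1 / 2 ^ (k + i)) * n := by
    intro k i n
    induction i with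
    | zero => simp
    | succ i ih =>
      have h := dyadicDistSum_add_le n (c (k + i) - c k) (c (k + (i + 1)) - c (k + i))
      rw [sub_add_sub_cancel'] at h
      have h2 : dyadicDistSum n (c (k + (i + 1)) - c (k + i)) ≤ 1 / 2 / 2 ^ (k + i) * n :=
        hsum (k + i) (a (k + i)) n
      refine h.trans ((add_le_add ih h2).trans_eq ?_)
      rw [← add_assoc, pow_succ]
      field_simp
      ring
  have hlim : ∀ k n : ℕ, dyadicDistSum n (x - c k) ≤ 1 / 2 ^ k * n := by
    intro k n
    refine le_of_tendsto (((continuous_dyadicDistSum n).tendsto _).comp (hx.sub_const (c k))) ?_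
    filter_upwards [eventually_ge_atTop k] with j hj
    obtain ⟨i, rfl⟩ := Nat.exists_eq_add_of_le hj
    refine (htail k i n).trans ?_
    gcongr
    have : (0 : ℝ) ≤ 1 / 2 ^ (k + i) := by positivity
    linarith
  rw [mem_GSet_iff, tendsto_order]
  refine ⟨fun b hb => .of_forall fun n =>
    hb.trans_le (div_nonneg (dyadicDistSum_nonneg n x) n.cast_nonneg), fun b hb => ?_⟩
  obtain ⟨k, hk⟩ := exists_pow_lt_of_lt_one (half_pos hb) (one_half_lt_one (α := ℝ))
  rw [one_div_pow] at hk
  filter_upwards [(mem_GSet_iff.1 (a k).2.1).eventually_lt_const (half_pos hb),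
    eventually_gt_atTop 0] with n hn hn0
  have hn0' : (0 : ℝ) < n := by exact_mod_cast hn0
  have h := dyadicDistSum_add_le n (c k) (x - c k)
  rw [add_sub_cancel] at h
  rw [div_lt_iff₀ hn0'] at hn ⊢
  have h2 := mul_lt_mul_of_pos_right hk hn0'
  change dyadicDistSum n (c k) < _ at hn
  linarith [hlim k n]

theorem stmt15 :
    MeasurableSet GSet ∧ (0 : ℝ) ∈ GSet ∧
      (∀ x ∈ GSet, ∀ y ∈ GSet, x + y ∈ GSet) ∧ (∀ x ∈ GSet, -x ∈ GSet) ∧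
      ¬ ∃ F : ℕ → Set ℝ, (∀ n, IsClosed (F n)) ∧ GSet = ⋃ n, F n := by
  refine ⟨measurableSet_GSet, zero_mem_GSet, fun x hx y hy => add_mem_GSet hx hy,
    fun x hx => neg_mem_GSet hx, ?_⟩
  rintro ⟨F, hF, hG⟩
  obtain ⟨x, hx, hxF⟩ := exists_mem_GSet_forall_notMem hF fun k => hG ▸ subset_iUnion F k
  rw [hG] at hx
  obtain ⟨k, hk⟩ := mem_iUnion.1 hx
  exact hxF k hk
end

section
/- BE(1,0), the set of real numbers whose binary digits contain 1's only on a set of density zero, is immeasurable: for every translation invariant Borel measure μ on ℝ, it is either μ-null or not σ-finite for μ. -/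
open MeasureTheory Set Filter Metric
open scoped ENNReal Pointwise Topology

/-- The number of ones in the binary expansion of a natural number. -/
def binaryWeight (n : ℕ) : ℕ := (Nat.digits 2 n).sum

theorem binaryWeight_zero : binaryWeight 0 = 0 := by simp [binaryWeight]

theorem binaryWeight_two_mul (n : ℕ) : binaryWeight (2 * n) = binaryWeight n := by
  rcases Nat.eq_zero_or_pos n with rfl | h
  · rfl
  · simp [binaryWeight, Nat.digits_base_mul (by norm_num : 1 < 2) h]

theorem binaryWeight_two_mul_add_one (n : ℕ) :
    binaryWeight (2 * n + 1) = binaryWeight n + 1 := by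
  rw [binaryWeight, Nat.digits_add_two_add_one 0 (2 * n)]
  have h₁ : (2 * n + 1) % (0 + 2) = 1 := by omega
  have h₂ : (2 * n + 1) / (0 + 2) = n := by omega
  rw [h₁, h₂, List.sum_cons, binaryWeight, add_comm]

theorem binaryWeight_succ_le (n : ℕ) : binaryWeight (n + 1) ≤ binaryWeight n + 1 := by
  induction n using Nat.strong_induction_on with
  | _ n ih =>
    obtain ⟨m, rfl | rfl⟩ := Nat.even_or_odd' n
    · rw [binaryWeight_two_mul_add_one, binaryWeight_two_mul]
    · have h := ih m (by omega)
      rw [show 2 * m + 1 + 1 = 2 * (m + 1) by ring, binaryWeight_two_mul,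
        binaryWeight_two_mul_add_one]
      omega

theorem binaryWeight_add_le (a b : ℕ) :
    binaryWeight (a + b) ≤ binaryWeight a + binaryWeight b := by
  induction a using Nat.strong_induction_on generalizing b with
  | _ a ih =>
    rcases Nat.eq_zero_or_pos a with rfl | ha
    · simp
    obtain ⟨m, rfl | rfl⟩ := Nat.even_or_odd' a <;> obtain ⟨k, rfl | rfl⟩ := Nat.even_or_odd' b
    · have h := ih m (by omega) k
      rw [← mul_add]
      simpa only [binaryWeight_two_mul] using h
    · have h := ih m (by omega) k
      rw [show 2 * m + (2 * k + 1) = 2 * (m + k) + 1 by ring]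
      simp only [binaryWeight_two_mul, binaryWeight_two_mul_add_one]
      omega
    · have h := ih m (by omega) k
      rw [show 2 * m + 1 + 2 * k = 2 * (m + k) + 1 by ring]
      simp only [binaryWeight_two_mul, binaryWeight_two_mul_add_one]
      omega
    · have h := ih m (by omega) k
      have h' := binaryWeight_succ_le (m + k)
      rw [show 2 * m + 1 + (2 * k + 1) = 2 * (m + k + 1) by ring]
      simp only [binaryWeight_two_mul, binaryWeight_two_mul_add_one]
      omega

theorem binaryWeight_le_add_two_pow {a n : ℕ} (h : a < 2 ^ n) :
    binaryWeight a ≤ binaryWeight (a + 2 ^ n) := by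
  induction n generalizing a with
  | zero => simp_all [binaryWeight]
  | succ n ih =>
    rw [pow_succ] at h
    obtain ⟨m, rfl | rfl⟩ := Nat.even_or_odd' a
    · rw [show 2 * m + 2 ^ (n + 1) = 2 * (m + 2 ^ n) by ring]
      simpa only [binaryWeight_two_mul] using ih (by omega)
    · rw [show 2 * m + 1 + 2 ^ (n + 1) = 2 * (m + 2 ^ n) + 1 by ring]
      simpa only [binaryWeight_two_mul_add_one, add_le_add_iff_right] using ih (by omega)

theorem binaryWeight_two_pow (n : ℕ) : binaryWeight (2 ^ n) = 1 := by
  induction n with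
  | zero => simp [binaryWeight]
  | succ n ih => rw [pow_succ', binaryWeight_two_mul, ih]

/-- The number whose base-four digits are the increments of `T`. -/
def incrementNum (T : ℕ → ℕ) : ℕ → ℕ
  | 0 => 0
  | k + 1 => 4 * incrementNum T k + (T (k + 1) - T k)

theorem incrementNum_succ {T : ℕ → ℕ} (hT : ∀ k, T (k + 1) = T k ∨ T (k + 1) = T k + 1) (k : ℕ) :
    (T (k + 1) = T k ∧ incrementNum T (k + 1) = 2 * (2 * incrementNum T k)) ∨
      (T (k + 1) = T k + 1 ∧ incrementNum T (k + 1) = 2 * (2 * incrementNum T k) + 1) := by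
  rcases hT k with h | h
  · refine Or.inl ⟨h, ?_⟩
    rw [incrementNum, h]
    omega
  · refine Or.inr ⟨h, ?_⟩
    rw [incrementNum, h]
    omega

theorem binaryWeight_incrementNum {T : ℕ → ℕ} (hT₀ : T 0 = 0)
    (hT : ∀ k, T (k + 1) = T k ∨ T (k + 1) = T k + 1) (k : ℕ) :
    binaryWeight (incrementNum T k) = T k := by
  induction k with
  | zero => simp [incrementNum, hT₀, binaryWeight]
  | succ k ih =>
    rcases incrementNum_succ hT k with ⟨h, h'⟩ | ⟨h, h'⟩
    · rw [h, h', binaryWeight_two_mul, binaryWeight_two_mul, ih]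
    · rw [h, h', binaryWeight_two_mul_add_one, binaryWeight_two_mul, ih]

/-- A number whose base-four digits are all `0` or `1` cannot be written as a difference of two
numbers with fewer binary ones in total. -/
theorem le_binaryWeight_add_incrementNum {T : ℕ → ℕ} (hT₀ : T 0 = 0)
    (hT : ∀ k, T (k + 1) = T k ∨ T (k + 1) = T k + 1) (k q : ℕ) :
    T k ≤ binaryWeight (incrementNum T k + q) + binaryWeight q ∧
      T k ≤ binaryWeight (incrementNum T k + q + 1) + binaryWeight q + 1 := by
  induction k generalizing q with
  | zero => simp [hT₀]
  | succ k ih =>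
    set A := incrementNum T k
    have key : ∀ p r, r < 4 → ∀ ε, T (k + 1) = T k + ε → ε ≤ 1 →
        incrementNum T (k + 1) = 2 * (2 * A) + ε → q = 4 * p + r →
        T (k + 1) ≤ binaryWeight (incrementNum T (k + 1) + q) + binaryWeight q ∧
          T (k + 1) ≤ binaryWeight (incrementNum T (k + 1) + q + 1) + binaryWeight q + 1 := by
      intro p r hr ε hTε hε hA hq
      obtain ⟨h₁, h₂⟩ := ih p
      have e : ∀ s, binaryWeight (4 * s) = binaryWeight s := fun s => by
        rw [show 4 * s = 2 * (2 * s) by ring, binaryWeight_two_mul, binaryWeight_two_mul]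
      have e₁ : ∀ s, binaryWeight (4 * s + 1) = binaryWeight s + 1 := fun s => by
        rw [show 4 * s + 1 = 2 * (2 * s) + 1 by ring, binaryWeight_two_mul_add_one,
          binaryWeight_two_mul]
      have e₂ : ∀ s, binaryWeight (4 * s + 2) = binaryWeight s + 1 := fun s => by
        rw [show 4 * s + 2 = 2 * (2 * s + 1) by ring, binaryWeight_two_mul,
          binaryWeight_two_mul_add_one]
      have e₃ : ∀ s, binaryWeight (4 * s + 3) = binaryWeight s + 2 := fun s => by
        rw [show 4 * s + 3 = 2 * (2 * s + 1) + 1 by ring, binaryWeight_two_mul_add_one,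
          binaryWeight_two_mul_add_one]
      have f : ∀ c, 2 * (2 * A) + ε + (4 * p + r) + c = 4 * (A + p) + (ε + r + c) := by
        intro c; ring
      have f₀ := f 0
      rw [add_zero] at f₀
      rw [hA, hTε, hq, f, f₀]
      have e₄ : binaryWeight (4 * (A + p) + 4) = binaryWeight (A + p + 1) := by
        rw [show 4 * (A + p) + 4 = 4 * (A + p + 1) by ring, e]
      have e₅ : binaryWeight (4 * (A + p) + 5) = binaryWeight (A + p + 1) + 1 := by
        rw [show 4 * (A + p) + 5 = 4 * (A + p + 1) + 1 by ring, e₁]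
      interval_cases ε <;> interval_cases r <;>
        simp only [e, e₁, e₂, e₃, e₄, e₅, Nat.reduceAdd, add_zero] <;> omega
    rcases incrementNum_succ hT k with ⟨h, h'⟩ | ⟨h, h'⟩
    · exact key (q / 4) (q % 4) (by omega) 0 (by omega) (by omega) h' (by omega)
    · exact key (q / 4) (q % 4) (by omega) 1 h le_rfl h' (by omega)

/-- The number of ones among the first `n` binary digits of `x`. -/
noncomputable def onesCount (x : ℝ) (n : ℕ) : ℕ :=
  ((Finset.Icc 1 n).filter (fun i => binDigit x i = 1)).card

theorem onesCount_mono (x : ℝ) : Monotone (onesCount x) := fun _ _ h =>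
  Finset.card_le_card (Finset.filter_subset_filter _ (Finset.Icc_subset_Icc_right h))

theorem mem_BE10_iff {x : ℝ} :
    x ∈ BE10 ↔ Tendsto (fun n : ℕ => (onesCount x n : ℝ) / n) atTop (𝓝 0) := Iff.rfl

/-- The number formed by the first `n` binary digits of `x`. -/
noncomputable def binPrefix (x : ℝ) (n : ℕ) : ℕ := ⌊Int.fract x * 2 ^ n⌋₊

theorem coe_binPrefix (x : ℝ) (n : ℕ) : (binPrefix x n : ℤ) = ⌊Int.fract x * 2 ^ n⌋ :=
  Int.natCast_floor_eq_floor (mul_nonneg (Int.fract_nonneg x) (by positivity))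

theorem binPrefix_lt (x : ℝ) (n : ℕ) : binPrefix x n < 2 ^ n := by
  rw [binPrefix, Nat.floor_lt (mul_nonneg (Int.fract_nonneg x) (by positivity))]
  push_cast
  exact mul_lt_of_lt_one_left (by positivity) (Int.fract_lt_one x)

theorem onesCount_eq (x : ℝ) (n : ℕ) : onesCount x n = binaryWeight (binPrefix x n) := by
  induction n with
  | zero =>
    have h := binPrefix_lt x 0
    rw [pow_zero, Nat.lt_one_iff] at h
    simp [h, onesCount, binaryWeight]
  | succ n ih =>
    have hcount : onesCount x (n + 1) =
        onesCount x n + if binDigit x (n + 1) = 1 then 1 else 0 := by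
      rw [onesCount, ← Finset.insert_Icc_right_eq_Icc_add_one (by omega), Finset.filter_insert]
      split_ifs
      · rw [Finset.card_insert_of_notMem (by simp)]; rfl
      · rfl
    have hdiv : binPrefix x (n + 1) / 2 = binPrefix x n := by
      rw [binPrefix, binPrefix, ← Nat.floor_div_natCast]
      congr 1
      push_cast
      rw [pow_succ]
      ring
    have hdig : binDigit x (n + 1) = ((binPrefix x (n + 1) % 2 : ℕ) : ℤ) := by
      rw [binDigit, ← coe_binPrefix]; norm_cast
    rw [hcount, ih, hdig, ← hdiv]
    obtain ⟨m, h | h⟩ := Nat.even_or_odd' (binPrefix x (n + 1)) <;> rw [h]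
    · simp [binaryWeight_two_mul]
    · rw [binaryWeight_two_mul_add_one, show (2 * m + 1) / 2 = m by omega]
      simp [Nat.add_mod]

/-- Adding two reals adds their binary prefixes, up to carries at both ends. -/
theorem binPrefix_add (x y : ℝ) (n : ℕ) : ∃ c ≤ 1, ∃ e ≤ 1,
    binPrefix x n + binPrefix y n + c = binPrefix (x + y) n + e * 2 ^ n := by
  obtain ⟨z, hz⟩ := Int.fract_add x y
  have hx := Int.fract_nonneg x
  have hy := Int.fract_nonneg y
  have hxy := Int.fract_nonneg (x + y)
  have hx' := Int.fract_lt_one x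
  have hy' := Int.fract_lt_one y
  have hxy' := Int.fract_lt_one (x + y)
  have hz₀ : (-2 : ℝ) < z := by linarith
  have hz₁ : (z : ℝ) < 1 := by linarith
  norm_cast at hz₀ hz₁
  have hfloor : ⌊Int.fract x * 2 ^ n + Int.fract y * 2 ^ n⌋ =
      ⌊Int.fract (x + y) * 2 ^ n⌋ + (-z) * 2 ^ n := by
    rw [← Int.floor_add_intCast]
    congr 1
    push_cast
    linear_combination -(2 ^ n) * hz
  have h₁ := Int.le_floor_add (Int.fract x * 2 ^ n) (Int.fract y * 2 ^ n)
  have h₂ := Int.le_floor_add_floor (Int.fract x * 2 ^ n) (Int.fract y * 2 ^ n)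
  rw [hfloor] at h₁ h₂
  simp only [← coe_binPrefix] at h₁ h₂
  obtain ⟨e, he⟩ := Int.eq_ofNat_of_zero_le (show 0 ≤ -z by omega)
  rw [he] at h₁ h₂
  rw [sub_le_iff_le_add] at h₂
  norm_cast at h₁ h₂
  refine ⟨binPrefix (x + y) n + e * 2 ^ n - (binPrefix x n + binPrefix y n), ?_, e, by omega, ?_⟩ <;>
    omega

theorem onesCount_add_le (x y : ℝ) (n : ℕ) :
    onesCount (x + y) n ≤ onesCount x n + onesCount y n + 1 := by
  obtain ⟨c, hc, e, he, h⟩ := binPrefix_add x y n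
  simp only [onesCount_eq]
  have h₁ : binaryWeight (binPrefix (x + y) n) ≤
      binaryWeight (binPrefix (x + y) n + e * 2 ^ n) := by
    interval_cases e
    · simp
    · simpa using binaryWeight_le_add_two_pow (binPrefix_lt (x + y) n)
  have h₂ : binaryWeight (binPrefix x n + binPrefix y n + c) ≤
      binaryWeight (binPrefix x n + binPrefix y n) + 1 := by
    interval_cases c
    · simp
    · exact binaryWeight_succ_le _
  have h₃ := binaryWeight_add_le (binPrefix x n) (binPrefix y n)
  rw [h] at h₂
  omega

theorem add_mem_BE10 {x y : ℝ} (hx : x ∈ BE10) (hy : y ∈ BE10) : x + y ∈ BE10 := by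
  rw [mem_BE10_iff] at *
  have h := (hx.add hy).add tendsto_one_div_atTop_nhds_zero_nat
  simp only [add_zero] at h
  refine squeeze_zero (fun n => by positivity) (fun n => ?_) h
  rw [← add_div, ← add_div]
  gcongr
  exact_mod_cast onesCount_add_le x y n

theorem le_onesCount_of_binPrefix_eq {T : ℕ → ℕ} (hT₀ : T 0 = 0)
    (hT : ∀ k, T (k + 1) = T k ∨ T (k + 1) = T k + 1) {g : ℝ}
    (hg : ∀ k, binPrefix g (2 * k) = incrementNum T k) (x : ℝ) (k : ℕ) :
    T k ≤ onesCount x (2 * k) + onesCount (x + g) (2 * k) + 2 := by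
  obtain ⟨c, hc, e, he, h⟩ := binPrefix_add g x (2 * k)
  rw [add_comm g x, hg] at h
  simp only [onesCount_eq]
  have h₁ : T k ≤ binaryWeight (incrementNum T k + binPrefix x (2 * k) + c) +
      binaryWeight (binPrefix x (2 * k)) + 1 := by
    obtain ⟨h₁, h₂⟩ := le_binaryWeight_add_incrementNum hT₀ hT k (binPrefix x (2 * k))
    interval_cases c
    · rw [add_zero]; omega
    · exact h₂
  have h₂ : binaryWeight (binPrefix (x + g) (2 * k) + e * 2 ^ (2 * k)) ≤
      binaryWeight (binPrefix (x + g) (2 * k)) + 1 := by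
    refine (binaryWeight_add_le _ _).trans ?_
    interval_cases e
    · simp [binaryWeight_zero]
    · simp [binaryWeight_two_pow]
  rw [h] at h₁
  omega

theorem exists_binPrefix_eq_incrementNum {T : ℕ → ℕ}
    (hT : ∀ k, T (k + 1) = T k ∨ T (k + 1) = T k + 1) :
    ∃ g : ℝ, ∀ k, binPrefix g (2 * k) = incrementNum T k := by
  set l : ℕ → ℝ := fun k => incrementNum T k / 4 ^ k with hl
  set u : ℕ → ℝ := fun k => (incrementNum T k + 1 / 2) / 4 ^ k with hu
  have hstep : ∀ k, (4 * incrementNum T k : ℝ) ≤ incrementNum T (k + 1) ∧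
      (incrementNum T (k + 1) : ℝ) ≤ 4 * incrementNum T k + 1 := by
    intro k
    have h := incrementNum_succ hT k
    constructor <;> norm_cast <;> omega
  have hl_mono : Monotone l := monotone_nat_of_le_succ fun k => by
    simp only [hl]
    rw [div_le_div_iff₀ (by positivity) (by positivity), pow_succ]
    nlinarith [(hstep k).1, show (0 : ℝ) < 4 ^ k by positivity]
  have hu_anti : Antitone u := antitone_nat_of_succ_le fun k => by
    simp only [hu]
    rw [div_le_div_iff₀ (by positivity) (by positivity), pow_succ]
    nlinarith [(hstep k).2, show (0 : ℝ) < 4 ^ k by positivity]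
  have hmem := hl_mono.ciSup_mem_iInter_Icc_of_antitone hu_anti fun k => by
    simp only [hl, hu]
    gcongr
    linarith
  set g := ⨆ k, l k
  simp only [mem_iInter, mem_Icc] at hmem
  have hfract : Int.fract g = g := by
    have h := hmem 0
    simp only [hl, hu, incrementNum] at h
    norm_num at h
    exact Int.fract_eq_self.2 ⟨h.1, by linarith [h.2]⟩
  refine ⟨g, fun k => ?_⟩
  obtain ⟨h₁, h₂⟩ := hmem k
  simp only [hl, hu] at h₁ h₂
  rw [div_le_iff₀ (by positivity)] at h₁
  rw [le_div_iff₀ (by positivity)] at h₂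
  rw [binPrefix, hfract, pow_mul, show (2 : ℝ) ^ 2 = 4 by norm_num,
    Nat.floor_eq_iff ((Nat.cast_nonneg _).trans h₁)]
  exact ⟨h₁, by linarith⟩

theorem mem_BE10_of_binPrefix_eq {T : ℕ → ℕ} (hT₀ : T 0 = 0)
    (hT : ∀ k, T (k + 1) = T k ∨ T (k + 1) = T k + 1)
    (hlim : Tendsto (fun k : ℕ => (T k : ℝ) / k) atTop (𝓝 0)) {g : ℝ}
    (hg : ∀ k, binPrefix g (2 * k) = incrementNum T k) : g ∈ BE10 := by
  have hmono : Monotone T := monotone_nat_of_le_succ fun k => by have := hT k; omega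
  rw [mem_BE10_iff]
  have h := hlim.add tendsto_one_div_atTop_nhds_zero_nat
  rw [add_zero] at h
  refine squeeze_zero (fun n => by positivity) (fun n => ?_) h
  rw [← add_div]
  gcongr
  have h₁ : onesCount g n ≤ T (n / 2 + 1) := by
    rw [← binaryWeight_incrementNum hT₀ hT, ← hg, ← onesCount_eq]
    exact onesCount_mono g (by omega)
  have h₂ : T (n / 2 + 1) ≤ T (n + 1) := hmono (by omega)
  have h₃ := hT n
  have h₄ : onesCount g n ≤ T n + 1 := by omega
  exact_mod_cast h₄

/-- For every rate `r` decreasing to zero there is a staircase growing at least as fast as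
`k * r k`, but still sublinearly. -/
theorem exists_staircase {r : ℕ → ℝ} (hr : Antitone r) (hr₁ : ∀ n, r n ≤ 1)
    (hlim : Tendsto r atTop (𝓝 0)) :
    ∃ T : ℕ → ℕ, T 0 = 0 ∧ (∀ k, T (k + 1) = T k ∨ T (k + 1) = T k + 1) ∧
      Tendsto (fun k : ℕ => (T k : ℝ) / k) atTop (𝓝 0) ∧ ∀ k : ℕ, k * r k < T k + 1 := by
  have hr₀ : ∀ n, 0 ≤ r n := fun n => hr.le_of_tendsto hlim n
  set F : ℕ → ℝ := fun k => ∑ i ∈ Finset.range k, r i with hF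
  have hF₀ : ∀ k, 0 ≤ F k := fun k => Finset.sum_nonneg fun i _ => hr₀ i
  have hF₁ : ∀ k, F (k + 1) = F k + r k := fun k => Finset.sum_range_succ _ _
  refine ⟨fun k => ⌊F k⌋₊, by simp [hF], fun k => ?_, ?_, fun k => ?_⟩
  · have h₁ : ⌊F k⌋₊ ≤ ⌊F (k + 1)⌋₊ := Nat.floor_mono (by linarith [hF₁ k, hr₀ k])
    have h₂ : ⌊F (k + 1)⌋₊ ≤ ⌊F k + 1⌋₊ := Nat.floor_mono (by linarith [hF₁ k, hr₁ k])
    rw [Nat.floor_add_one (hF₀ k)] at h₂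
    dsimp only
    omega
  · refine squeeze_zero (fun k => by positivity) (fun k => ?_) hlim.cesaro
    rw [div_eq_inv_mul]
    gcongr
    exact Nat.floor_le (hF₀ k)
  · refine lt_of_le_of_lt ?_ (Nat.lt_floor_add_one (F k))
    calc (k : ℝ) * r k = ∑ _i ∈ Finset.range k, r k := by simp
      _ ≤ F k := Finset.sum_le_sum fun i hi => hr (Finset.mem_range.1 hi).le

theorem measurable_onesCount (n : ℕ) : Measurable fun x : ℝ => (onesCount x n : ℝ) := by
  have h : (fun x : ℝ => (onesCount x n : ℝ)) =
      fun x => ∑ i ∈ Finset.Icc 1 n, if binDigit x i = 1 then (1 : ℝ) else 0 := by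
    ext x
    simp [onesCount]
  rw [h]
  refine Finset.measurable_sum _ fun i _ => ?_
  have hd : Measurable fun x : ℝ => binDigit x i :=
    (measurable_from_top (f := fun m : ℤ => m % 2)).comp
      (Int.measurable_floor.comp (measurable_fract.mul_const _))
  exact Measurable.ite (hd (measurableSet_singleton 1)) measurable_const measurable_const

/-- A sequence of measurable functions converging to zero on `B` does so, almost everywhere, at a
common rate. -/
theorem exists_rate {α : Type*} [MeasurableSpace α] {ν : Measure α} [IsFiniteMeasure ν]
    {B : Set α} (hB : MeasurableSet B) {u : ℕ → α → ℝ} (hu : ∀ n, Measurable (u n))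
    (hlim : ∀ x ∈ B, Tendsto (fun n => u n x) atTop (𝓝 0)) :
    ∃ r : ℕ → ℝ, Antitone r ∧ (∀ n, r n ≤ 1) ∧ Tendsto r atTop (𝓝 0) ∧
      ∀ᵐ x ∂ν, x ∈ B → ∀ᶠ n in atTop, u n x ≤ r n := by
  set D : ℕ → ℕ → Set α := fun j N => B ∩ ⋃ n ≥ N, {x | 1 / ((j : ℝ) + 1) < u n x} with hD
  have hDmeas : ∀ j N, MeasurableSet (D j N) := fun j N =>
    hB.inter (MeasurableSet.iUnion fun n => MeasurableSet.iUnion fun _ =>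
      measurableSet_lt measurable_const (hu n))
  have hDanti : ∀ j, Antitone (D j) := fun j N M h =>
    inter_subset_inter_right _ (biUnion_subset_biUnion_left fun n hn => le_trans h hn)
  have hDempty : ∀ j, ⋂ N, D j N = ∅ := fun j => by
    refine eq_empty_of_forall_notMem fun x hx => ?_
    have hx' := mem_iInter.1 hx
    have hev := (hlim x (hx' 0).1).eventually_lt_const
      (show (0 : ℝ) < 1 / ((j : ℝ) + 1) by positivity)
    obtain ⟨N, hN⟩ := eventually_atTop.1 hev
    obtain ⟨-, h⟩ := hx' N
    simp only [mem_iUnion, mem_ofPred_eq] at h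
    obtain ⟨n, hn, h⟩ := h
    exact lt_asymm h (hN n hn)
  have hsmall : ∀ j, ∃ N, ν (D j N) < 2⁻¹ ^ j := fun j => by
    have h := tendsto_measure_iInter_atTop (μ := ν)
      (fun N => (hDmeas j N).nullMeasurableSet) (hDanti j) ⟨0, measure_ne_top _ _⟩
    rw [hDempty, measure_empty] at h
    exact (h.eventually_lt_const (show (0 : ℝ≥0∞) < 2⁻¹ ^ j from
      ENNReal.pow_pos (by simp) j)).exists
  choose N hN using hsmall
  have hsum : ∑' j, ν (D j (N j)) ≠ ⊤ := by
    refine ne_top_of_le_ne_top ENNReal.ofNat_ne_top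
      ((ENNReal.tsum_le_tsum fun j => (hN j).le).trans ENNReal.tsum_geometric_two.le)
  set φ : ℕ → ℕ := fun n => Nat.findGreatest (fun j => N j ≤ n) n with hφ
  have hφmono : Monotone φ := fun n m h =>
    Nat.findGreatest_mono (fun j hj => le_trans hj h) h
  have hφtop : Tendsto φ atTop atTop := tendsto_atTop.2 fun j => by
    filter_upwards [eventually_ge_atTop (max j (N j))] with n hn
    exact Nat.le_findGreatest ((le_max_left _ _).trans hn) ((le_max_right _ _).trans hn)
  refine ⟨fun n => 1 / ((φ n : ℝ) + 1), fun n m h => ?_, fun n => ?_, ?_, ?_⟩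
  · have := hφmono h
    dsimp only
    gcongr
  · rw [div_le_one (by positivity)]
    simp
  · exact tendsto_one_div_add_atTop_nhds_zero_nat.comp hφtop
  · filter_upwards [ae_eventually_notMem hsum] with x hx hxB
    filter_upwards [hφtop.eventually hx, eventually_ge_atTop (N 0)] with n hn hn₀
    have hspec : N (φ n) ≤ n :=
      Nat.findGreatest_spec (P := fun j => N j ≤ n) (Nat.zero_le n) hn₀
    by_contra! hlt
    exact hn ⟨hxB, mem_biUnion (show n ∈ {m | m ≥ N (φ n)} from hspec) hlt⟩

theorem stmt16 :
    ∀ μ : Measure ℝ, TransInv μ → μ BE10 = 0 ∨ ¬ SigmaFiniteOn μ BE10 := by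
  intro μ hμ
  rw [or_iff_not_imp_right, not_not]
  rintro ⟨s, hs, hsfin, hB⟩
  have hBmeas : MeasurableSet BE10 := hB ▸ MeasurableSet.iUnion hs
  have : ∀ n, IsFiniteMeasure (μ.restrict (s n)) := fun n => ⟨by simpa using hsfin n⟩
  set ρ := Measure.sum fun n => μ.restrict (s n) with hρ
  have hle : μ.restrict BE10 ≤ ρ := by
    rw [hB]
    exact Measure.restrict_iUnion_le
  have hac : μ.restrict BE10 ≪ ρ.toFinite :=
    hle.absolutelyContinuous.trans (absolutelyContinuous_toFinite ρ)
  set u : ℕ → ℝ → ℝ := fun k x => (2 * onesCount x (2 * k) + 4) / k with hu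
  have humeas : ∀ k, Measurable (u k) := fun k =>
    (((measurable_onesCount (2 * k)).const_mul 2).add_const 4).div_const _
  have hulim : ∀ x ∈ BE10, Tendsto (fun k => u k x) atTop (𝓝 0) := by
    intro x hx
    have h₁ := (mem_BE10_iff.1 hx).comp (tendsto_id.const_mul_atTop' (show 0 < 2 by norm_num))
    have h₂ := (h₁.const_mul 4).add (tendsto_one_div_atTop_nhds_zero_nat.const_mul (4 : ℝ))
    simp only [mul_zero, add_zero] at h₂
    refine h₂.congr fun k => ?_
    simp only [hu, Function.comp_apply, id]
    rcases Nat.eq_zero_or_pos k with rfl | hk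
    · simp
    · push_cast
      field_simp
      ring
  obtain ⟨r, hr, hr₁, hrlim, hae⟩ := exists_rate (ν := ρ.toFinite) hBmeas humeas hulim
  obtain ⟨T, hT₀, hT, hTlim, hTr⟩ := exists_staircase hr hr₁ hrlim
  obtain ⟨g, hg⟩ := exists_binPrefix_eq_incrementNum hT
  have hgB := mem_BE10_of_binPrefix_eq hT₀ hT hTlim hg
  set E : Set ℝ := BE10 ∩ {x | ∀ᶠ k in atTop, u k x ≤ r k} with hE
  have hEmeas : MeasurableSet E := by
    refine hBmeas.inter ?_
    simp only [eventually_atTop, ofPred_exists, ofPred_forall]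
    exact MeasurableSet.iUnion fun N => MeasurableSet.iInter fun k => MeasurableSet.iInter fun _ =>
      measurableSet_le (humeas k) measurable_const
  have hnull : μ (BE10 \ E) = 0 := by
    have h := (ae_restrict_iff' hBmeas).1 (hac.ae_le hae)
    refine measure_mono_null (fun x hx => ?_) (ae_iff.1 h)
    simp only [mem_ofPred_eq]
    intro hx'
    exact hx.2 ⟨hx.1, hx' hx.1 hx.1⟩
  have hsub : (· + g) '' E ⊆ BE10 \ E := by
    rintro _ ⟨x, hx, rfl⟩
    refine ⟨add_mem_BE10 hx.1 hgB, fun hxg => ?_⟩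
    obtain ⟨k, ⟨h₁, h₂⟩, hk⟩ := ((hx.2.and hxg.2).and (eventually_gt_atTop 0)).exists
    have hk' : (0 : ℝ) < k := by exact_mod_cast hk
    simp only [hu] at h₁ h₂
    rw [div_le_iff₀ hk'] at h₁ h₂
    have h₃ : (T k : ℝ) ≤ onesCount x (2 * k) + onesCount (x + g) (2 * k) + 2 := by
      exact_mod_cast le_onesCount_of_binPrefix_eq hT₀ hT hg x k
    have h₄ := hTr k
    linarith
  have hEnull : μ E = 0 := by
    rw [← hμ E hEmeas g]
    exact measure_mono_null hsub hnull
  refine measure_mono_null (fun x hx => ?_) (measure_union_null hEnull hnull)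
  exact (em (x ∈ E)).imp id fun h => ⟨hx, h⟩
end

section
/- Let M be a meager subset of ℝ \ {0}. Then the generic compact subset C of ℝ (i.e., comeager many elements of the hyperspace of compact subsets of ℝ with the Hausdorff metric) is a Cantor set that is linearly independent over ℚ and such that the additive group generated by C is disjoint from M. -/
open Set Filter Topology TopologicalSpace

section CantorCharacterization

variable {X : Type*} [TopologicalSpace X] [CompactSpace X] [T2Space X] [TotallyDisconnectedSpace X]
  [PerfectSpace X]

/-- A nonempty clopen set of a perfect space can be split into two nonempty clopen pieces, along a
prescribed clopen set whenever that set cuts it. -/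
theorem exists_isClopen_splitting {A : Set X} (hA : IsClopen A) (hne : A.Nonempty) {U : Set X}
    (hU : IsClopen U) :
    ∃ B, IsClopen B ∧ (A ∩ B).Nonempty ∧ (A \ B).Nonempty ∧
      ((A ∩ U).Nonempty → (A \ U).Nonempty → B = U) := by
  by_cases h : (A ∩ U).Nonempty ∧ (A \ U).Nonempty
  · exact ⟨U, hU, h.1, h.2, fun _ _ => rfl⟩
  obtain ⟨x, hx⟩ := hne
  obtain ⟨y, hy, hyx⟩ : ∃ y ∈ A, y ≠ x := by
    by_contra! hcon
    have hAx : A = {x} := eq_singleton_iff_unique_mem.2 ⟨hx, hcon⟩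
    exact (PerfectSpace.not_isolated x).ne
      ((isOpen_singleton_iff_punctured_nhds x).1 (hAx ▸ hA.isOpen))
  obtain ⟨V, hV, hxV, hyV⟩ := exists_isClopen_of_totally_separated hyx.symm
  exact ⟨V, hV, ⟨x, hx, hxV⟩, ⟨y, hy, hyV⟩, fun h₁ h₂ => absurd ⟨h₁, h₂⟩ h⟩

/-- Brouwer's characterization of the Cantor space. -/
theorem nonempty_homeomorph_nat_bool [SecondCountableTopology X] [Nonempty X] :
    Nonempty (X ≃ₜ (ℕ → Bool)) := by
  classical
  have : Countable (Clopens X) := Clopens.countable_iff_secondCountable.2 inferInstance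
  obtain ⟨U, hU⟩ := exists_surjective_nat (Clopens X)
  choose! D hDclopen hDne hDne' hDsplit using
    fun (k : ℕ) (A : Set X) (hA : IsClopen A ∧ A.Nonempty) =>
      exists_isClopen_splitting hA.1 hA.2 (U k).isClopen
  let A : List Bool → Set X := fun l => l.rec univ
    fun b l A => if b then A ∩ D l.length A else A \ D l.length A
  have hAcons (b : Bool) (l : List Bool) :
      A (b :: l) = if b then A l ∩ D l.length (A l) else A l \ D l.length (A l) := rfl
  have hA (l : List Bool) : IsClopen (A l) ∧ (A l).Nonempty := by
    induction l with
    | nil => exact ⟨isClopen_univ, univ_nonempty⟩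
    | cons b l ih =>
      rw [hAcons]
      cases b
      · exact ⟨ih.1.diff (hDclopen _ _ ih), hDne' _ _ ih⟩
      · exact ⟨ih.1.inter (hDclopen _ _ ih), hDne _ _ ih⟩
  let L : X → ℕ → List Bool := fun x n => n.rec []
    fun k l => decide (x ∈ D k (A l)) :: l
  have hLsucc (x : X) (n : ℕ) : L x (n + 1) = decide (x ∈ D n (A (L x n))) :: L x n := rfl
  have hLlen (x : X) (n : ℕ) : (L x n).length = n := by
    induction n with
    | zero => rfl
    | succ n ih => rw [hLsucc, List.length_cons, ih]
  have hxL (x : X) (n : ℕ) : x ∈ A (L x n) := by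
    induction n with
    | zero => exact mem_univ x
    | succ n ih =>
      rw [hLsucc, hAcons, hLlen]
      by_cases hx : x ∈ D n (A (L x n)) <;> simp [hx, ih]
  have hLeq (x : X) (l : List Bool) (hx : x ∈ A l) : L x l.length = l := by
    induction l with
    | nil => rfl
    | cons b l ih =>
      rw [hAcons] at hx
      cases b
      · rw [List.length_cons, hLsucc, ih hx.1]
        simpa using hx.2
      · rw [List.length_cons, hLsucc, ih hx.1]
        simpa using hx.2
  let f : X → ℕ → Bool := fun x n => decide (x ∈ D n (A (L x n)))
  have hf_cont : Continuous f := by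
    refine continuous_pi fun n => continuous_def.2 fun s _ => isOpen_iff_mem_nhds.2 fun x hx => ?_
    filter_upwards [(hA (L x (n + 1))).1.isOpen.mem_nhds (hxL x (n + 1))] with y hy
    have h := hLeq y (L x (n + 1)) hy
    rw [hLlen x (n + 1), hLsucc, hLsucc, List.cons.injEq] at h
    have : f y n = f x n := h.1
    simpa [this] using hx
  have hL_of_f (x y : X) (h : f x = f y) (n : ℕ) : L x n = L y n := by
    induction n with
    | zero => rfl
    | succ n ih => exact congrArg₂ List.cons (congrFun h n) ih
  have hf_inj : Function.Injective f := by
    intro x y hxy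
    by_contra hne
    obtain ⟨V, hV, hxV, hyV⟩ := exists_isClopen_of_totally_separated hne
    obtain ⟨n, hn⟩ := hU ⟨V, hV⟩
    have hL := hL_of_f x y hxy n
    have hVU : (U n : Set X) = V := by rw [hn]; rfl
    have hD : D n (A (L x n)) = V := by
      rw [← hVU]
      refine hDsplit n _ (hA _) ⟨x, hxL x n, hVU ▸ hxV⟩ ⟨y, hL ▸ hxL y n, ?_⟩
      rw [hVU]
      exact hyV
    have h := congrFun hxy n
    simp only [f, ← hL, hD, decide_eq_decide] at h
    exact hyV (h.1 hxV)
  have hf_surj : Function.Surjective f := by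
    intro y
    let R : ℕ → List Bool := fun n => n.rec [] fun k l => y k :: l
    have hRsucc (n : ℕ) : R (n + 1) = y n :: R n := rfl
    have hRlen (n : ℕ) : (R n).length = n := by
      induction n with
      | zero => rfl
      | succ n ih => rw [hRsucc, List.length_cons, ih]
    obtain ⟨x, hx⟩ := IsCompact.nonempty_iInter_of_sequence_nonempty_isCompact_isClosed
      (fun n => A (R n))
      (fun n => by
        rw [hRsucc, hAcons]
        split_ifs
        exacts [inter_subset_left, sdiff_subset])
      (fun n => (hA _).2) (hA (R 0)).1.isClosed.isCompact (fun n => (hA _).1.isClosed)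
    refine ⟨x, funext fun n => ?_⟩
    have h := hLeq x (R (n + 1)) (mem_iInter.1 hx (n + 1))
    rw [hRlen (n + 1), hRsucc, hLsucc, List.cons.injEq] at h
    exact h.1
  exact ⟨Continuous.homeoOfEquivCompactToT2 (f := Equiv.ofBijective f ⟨hf_inj, hf_surj⟩) hf_cont⟩

end CantorCharacterization

/-- Avoiding a closed set of tuples is an open condition on compact sets. -/
theorem isOpen_setOf_forall_pi_notMem {X ι : Type*} [MetricSpace X] [Fintype ι] {E : Set (ι → X)}
    (hE : IsClosed E) :
    IsOpen {C : NonemptyCompacts X | ∀ x : ι → X, (∀ i, x i ∈ C) → x ∉ E} := by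
  rw [Metric.isOpen_iff]
  intro C hC
  obtain ⟨r, hr, hsub⟩ := (isCompact_univ_pi fun _ : ι => C.isCompact).exists_thickening_subset_open
    hE.isOpen_compl (fun x hx => hC x fun i => hx i (mem_univ i))
  refine ⟨r, hr, fun C' hC' x hx => hsub ?_⟩
  have hdist : Metric.hausdorffDist (C' : Set X) C < r := by
    rwa [Metric.mem_ball, Metric.NonemptyCompacts.dist_eq] at hC'
  choose y hyC hy using fun i => Metric.exists_dist_lt_of_hausdorffDist_lt (hx i) hdist
    (Metric.hausdorffEDist_ne_top_of_nonempty_of_bounded C'.nonempty C.nonempty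
      C'.isCompact.isBounded C.isCompact.isBounded)
  exact Metric.mem_thickening_iff.2 ⟨y, fun i _ => hyC i, (dist_pi_lt_iff hr).2 hy⟩

theorem isOpenMap_comp_of_injective {ι κ : Type*} [Finite ι] [Finite κ] {σ : ι → κ}
    (hσ : σ.Injective) : IsOpenMap fun y : κ → ℝ => y ∘ σ :=
  (LinearMap.funLeft ℝ ℝ σ).isOpenMap_of_finiteDimensional
    (LinearMap.funLeft_surjective_of_injective ℝ ℝ σ hσ)

/-- In every nonempty open set of compacta there is a finite set all of whose injective tuples avoid
a given meagre set. -/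
theorem dense_setOf_forall_injective_notMem {ι : Type*} [Finite ι] {R : Set (ι → ℝ)}
    (hR : IsMeagre R) :
    Dense {C : NonemptyCompacts ℝ | ∀ x : ι → ℝ, x.Injective → (∀ i, x i ∈ C) → x ∉ R} := by
  rw [dense_iff_inter_open]
  intro 𝒰 h𝒰 hne
  obtain ⟨F, hF𝒰, hF⟩ := NonemptyCompacts.dense_setOfPred_finite.inter_open_nonempty 𝒰 h𝒰 hne
  have : Finite ↥(F : Set ℝ) := Set.Finite.to_subtype hF
  have : Nonempty (F : Set ℝ) := F.nonempty.to_subtype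
  let Φ : (↥(F : Set ℝ) → ℝ) → NonemptyCompacts ℝ := fun y =>
    ⟨⟨range y, (finite_range y).isCompact⟩, range_nonempty y⟩
  let := TopologicalSpace.vietoris ℝ
  have hΦ : Continuous Φ :=
    NonemptyCompacts.isEmbedding_coe.continuous_iff.2 vietoris.continuous_range_of_finite
  have hΦF : Φ Subtype.val = F := SetLike.coe_injective Subtype.range_coe
  have hmeagre : IsMeagre (⋃ σ : {σ : ι → (F : Set ℝ) // σ.Injective},
      (fun y : ↥(F : Set ℝ) → ℝ => y ∘ σ.1) ⁻¹' R) :=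
    isMeagre_iUnion fun σ => hR.preimage_of_isOpenMap (by fun_prop)
      (isOpenMap_comp_of_injective σ.2)
  obtain ⟨y, hy𝒰, hy⟩ := (dense_of_mem_residual hmeagre).inter_open_nonempty _ (h𝒰.preimage hΦ)
    ⟨Subtype.val, by rwa [mem_preimage, hΦF]⟩
  refine ⟨Φ y, hy𝒰, fun x hx hxC hxR => hy ?_⟩
  choose σ hσ using fun i => mem_range.1 (hxC i)
  have hyσ : y ∘ σ = x := funext hσ
  exact mem_iUnion.2 ⟨⟨σ, .of_comp (hyσ ▸ hx)⟩, by rwa [mem_preimage, hyσ]⟩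

/-- Injective tuples from the generic compact set avoid a given meagre set. -/
theorem eventually_residual_forall_injective_notMem {ι : Type*} [Finite ι] {R : Set (ι → ℝ)}
    (hR : IsMeagre R) :
    ∀ᶠ C : NonemptyCompacts ℝ in residual (NonemptyCompacts ℝ),
      ∀ x : ι → ℝ, x.Injective → (∀ i, x i ∈ C) → x ∉ R := by
  have := Fintype.ofFinite ι
  obtain ⟨S, hS, hScount, hRS⟩ := isMeagre_iff_countable_union_isNowhereDense.1 hR
  let Sep : ℕ → Set (ι → ℝ) := fun k => {x | ∀ i j, i ≠ j → 1 / ((k : ℝ) + 1) ≤ dist (x i) (x j)}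
  have hSep (k : ℕ) : IsClosed (Sep k) := by
    simp only [Sep, ofPred_forall]
    exact isClosed_iInter fun i => isClosed_iInter fun j => isClosed_iInter fun _ =>
      isClosed_le (by fun_prop) (by fun_prop)
  have hgen (t : Set (ι → ℝ)) (ht : t ∈ S) (k : ℕ) : ∀ᶠ C : NonemptyCompacts ℝ in
      residual (NonemptyCompacts ℝ), ∀ x : ι → ℝ, (∀ i, x i ∈ C) → x ∉ closure t ∩ Sep k := by
    refine residual_of_dense_open
      (isOpen_setOf_forall_pi_notMem (isClosed_closure.inter (hSep k)))
      ((dense_setOf_forall_injective_notMem (hS t ht).closure.isMeagre).mono ?_)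
    rintro C hC x hxC ⟨hxt, hxk⟩
    refine hC x (fun i j hij => ?_) hxC hxt
    by_contra hne
    have := hxk i j hne
    rw [hij, dist_self] at this
    exact this.not_gt Nat.one_div_pos_of_nat
  filter_upwards [(eventually_countable_ball hScount).2 fun t ht =>
    eventually_countable_forall.2 (hgen t ht)] with C hC x hx hxC hxR
  obtain ⟨t, ht, hxt⟩ := hRS hxR
  obtain ⟨k, hk⟩ : ∃ k, x ∈ Sep k := by
    have hfin : ∀ᶠ k : ℕ in atTop, ∀ i j, i ≠ j → 1 / ((k : ℝ) + 1) ≤ dist (x i) (x j) := by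
      simp only [eventually_all]
      intro i j hij
      exact (tendsto_one_div_add_atTop_nhds_zero_nat.eventually_lt_const
        (dist_pos.2 (hx.ne hij))).mono fun _ h => h.le
    exact hfin.exists
  exact hC t ht k x hxC ⟨subset_closure hxt, hk⟩

/-- The generic compact set has no isolated points. -/
theorem eventually_residual_perfectSpace :
    ∀ᶠ C : NonemptyCompacts ℝ in residual (NonemptyCompacts ℝ), PerfectSpace (C : Set ℝ) := by
  have key (p q : ℚ) (hpq : p < q) : ∀ᶠ C : NonemptyCompacts ℝ in residual (NonemptyCompacts ℝ),
      (C : Set ℝ) ⊆ (Icc (p : ℝ) q)ᶜ ∨ ∃ r : ℝ, ((C : Set ℝ) ∩ Ioo (p : ℝ) r).Nonempty ∧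
        ((C : Set ℝ) ∩ Ioo r (q : ℝ)).Nonempty := by
    refine residual_of_dense_open ?_ ?_
    · simp only [ofPred_or, ofPred_exists]
      exact (NonemptyCompacts.isOpen_subsets_of_isOpen isClosed_Icc.isOpen_compl).union
        (isOpen_iUnion fun r => (NonemptyCompacts.isOpen_inter_nonempty_of_isOpen isOpen_Ioo).inter
          (NonemptyCompacts.isOpen_inter_nonempty_of_isOpen isOpen_Ioo))
    rw [dense_iff_inter_open]
    rintro 𝒰 h𝒰 ⟨C, hC⟩
    by_cases hsub : (C : Set ℝ) ⊆ (Icc (p : ℝ) q)ᶜ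
    · exact ⟨C, hC, .inl hsub⟩
    have hsup (D : NonemptyCompacts ℝ) : IsOpen {t : ℝ | D ⊔ {t} ∈ 𝒰} :=
      h𝒰.preimage (continuous_const.sup NonemptyCompacts.continuous_singleton)
    have hsup_self {D : NonemptyCompacts ℝ} {t : ℝ} (ht : t ∈ D) : D ⊔ {t} = D :=
      SetLike.coe_injective (by simpa using ht)
    obtain ⟨x, hxC, hx⟩ := not_subset.1 hsub
    rw [notMem_compl_iff, ← closure_Ioo (Rat.cast_injective.ne hpq.ne)] at hx
    obtain ⟨z, hz𝒰, hz⟩ := mem_closure_iff.1 hx _ (hsup C) (by rwa [mem_ofPred_eq, hsup_self hxC])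
    have hopen : IsOpen ({t : ℝ | C ⊔ {z} ⊔ {t} ∈ 𝒰} ∩ Ioo (p : ℝ) q) :=
      (hsup (C ⊔ {z})).inter isOpen_Ioo
    have hzCz : z ∈ C ⊔ {z} := show z ∈ (C : Set ℝ) ∪ {z} from .inr rfl
    obtain ⟨w, hwz, hw𝒰, hw⟩ := (dense_compl_singleton z).inter_open_nonempty _ hopen
      ⟨z, by rwa [mem_ofPred_eq, hsup_self hzCz], hz⟩ |>.imp fun _ h => h.symm
    have hzD : z ∈ ((C ⊔ {z} ⊔ {w} : NonemptyCompacts ℝ) : Set ℝ) := by simp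
    have hwD : w ∈ ((C ⊔ {z} ⊔ {w} : NonemptyCompacts ℝ) : Set ℝ) := by simp
    refine ⟨C ⊔ {z} ⊔ {w}, hw𝒰, .inr ?_⟩
    rcases lt_or_gt_of_ne (show w ≠ z from hwz) with h | h
    · obtain ⟨r, hwr, hrz⟩ := exists_between h
      exact ⟨r, ⟨w, hwD, hw.1, hwr⟩, z, hzD, hrz, hz.2⟩
    · obtain ⟨r, hzr, hrw⟩ := exists_between h
      exact ⟨r, ⟨z, hzD, hz.1, hzr⟩, w, hwD, hrw, hw.2⟩
  filter_upwards [eventually_countable_forall.2 fun p => eventually_countable_forall.2 fun q =>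
    eventually_imp_distrib_left.2 (key p q)]
    with C hC
  refine perfectSpace_iff_forall_not_isolated.2 fun x => neBot_iff.2 fun hx => ?_
  obtain ⟨U, hU, hUx⟩ := isOpen_induced_iff.1 ((isOpen_singleton_iff_punctured_nhds x).2 hx)
  have hxU : (x : ℝ) ∈ U := by
    have : x ∈ Subtype.val ⁻¹' U := hUx ▸ mem_singleton x
    exact this
  have hUC {y : ℝ} (hyU : y ∈ U) (hyC : y ∈ (C : Set ℝ)) : y = x := by
    have : (⟨y, hyC⟩ : ↥(C : Set ℝ)) ∈ Subtype.val ⁻¹' U := hyU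
    rw [hUx] at this
    exact congrArg Subtype.val this
  obtain ⟨a, b, ⟨hax, hxb⟩, hab⟩ := mem_nhds_iff_exists_Ioo_subset.1 (hU.mem_nhds hxU)
  obtain ⟨p, hap, hpx⟩ := exists_rat_btwn hax
  obtain ⟨q, hxq, hqb⟩ := exists_rat_btwn hxb
  rcases hC p q (Rat.cast_lt.1 (hpx.trans hxq)) with h | ⟨r, ⟨y, hyC, hpy, hyr⟩, z, hzC, hrz, hzq⟩
  · exact h x.2 ⟨hpx.le, hxq.le⟩
  · have hyz := hyr.trans hrz
    have hy := hUC (hab ⟨hap.trans hpy, (hyz.trans hzq).trans hqb⟩) hyC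
    have hz := hUC (hab ⟨hap.trans (hpy.trans hyz), hzq.trans hqb⟩) hzC
    exact hyz.ne (hy.trans hz.symm)

theorem isMeagre_setOf_sum_mem {ι : Type*} [Fintype ι] {c : ι → ℤ} (hc : c ≠ 0) {M : Set ℝ}
    (hM : IsMeagre M) : IsMeagre {x : ι → ℝ | ∑ i, c i • x i ∈ M} := by
  classical
  obtain ⟨i, hi⟩ := Function.ne_iff.1 hc
  let T : (ι → ℝ) →ₗ[ℝ] ℝ := ∑ i, (c i : ℝ) • LinearMap.proj i
  have hT (x : ι → ℝ) : T x = ∑ i, c i • x i := by simp [T]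
  have hTsurj : Function.Surjective T := by
    refine T.surjective_of_ne_zero fun h => hi ?_
    have := hT (Pi.single i 1)
    simpa [h, Pi.single_apply] using this.symm
  have := hM.preimage_of_isOpenMap T.continuous_of_finiteDimensional
    (T.isOpenMap_of_finiteDimensional hTsurj)
  simpa only [preimage, hT] using this

theorem exists_fin_sum_eq_linearCombination {C : Set ℝ} {l : C →₀ ℤ} (hl : l ≠ 0) :
    ∃ (n : ℕ) (c : Fin n → ℤ) (x : Fin n → ℝ), c ≠ 0 ∧ x.Injective ∧ (∀ i, x i ∈ C) ∧
      ∑ i, c i • x i = Finsupp.linearCombination ℤ (Subtype.val : C → ℝ) l := by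
  let e := l.support.equivFin.symm
  refine ⟨l.support.card, fun i => l (e i), fun i => (e i : C), ?_, ?_, fun i => (e i : C).2, ?_⟩
  · obtain ⟨a, ha⟩ := Finsupp.support_nonempty_iff.2 hl
    intro h
    have := congrFun h (e.symm ⟨a, ha⟩)
    simp only [Equiv.apply_symm_apply, Pi.zero_apply] at this
    exact Finsupp.mem_support_iff.1 ha this
  · exact Subtype.val_injective.comp (Subtype.val_injective.comp e.injective)
  · rw [Finsupp.linearCombination_apply, Finsupp.sum, ← Finset.sum_coe_sort l.support]
    exact e.sum_comp fun a : l.support => l a • ((a : C) : ℝ)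

theorem isTotallyDisconnected_of_linearIndependent {C : Set ℝ}
    (hC : LinearIndependent ℚ (Subtype.val : C → ℝ)) : IsTotallyDisconnected C := by
  rw [isTotallyDisconnected_iff_lt]
  intro x _ y _ hxy
  by_contra! h
  obtain ⟨a, hxa, hay⟩ := exists_rat_btwn hxy
  obtain ⟨b, hab, hby⟩ := exists_rat_btwn hay
  have haC : (a : ℝ) ∈ C := by_contra fun hn => h a hn ⟨hxa, hay⟩
  have hbC : (b : ℝ) ∈ C := by_contra fun hn => h b hn ⟨hxa.trans hab, hby⟩
  have hinj : Function.Injective ![(⟨a, haC⟩ : C), ⟨b, hbC⟩] := by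
    rw [Function.Injective, Fin.forall_fin_two]
    simp [Fin.forall_fin_two, hab.ne, hab.ne']
  have hpair : LinearIndependent ℚ ![(a : ℝ), b] := by
    convert hC.comp _ hinj using 1
    ext i
    fin_cases i <;> rfl
  obtain ⟨hb, ha⟩ := LinearIndependent.pair_iff.1 hpair b (-a) (by
    simp only [Rat.smul_def, Rat.cast_neg]
    ring)
  rw [hb, neg_eq_zero.1 ha] at hab
  exact lt_irrefl _ hab

theorem stmt17 (M : Set ℝ) (hM : M ⊆ {(0 : ℝ)}ᶜ) (hMmeager : IsMeagre M) :
    {C : NonemptyCompacts ℝ |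
        Nonempty (↥(C : Set ℝ) ≃ₜ (ℕ → Bool)) ∧
        LinearIndependent ℚ (Subtype.val : ↥(C : Set ℝ) → ℝ) ∧
        Disjoint (AddSubgroup.closure (C : Set ℝ) : Set ℝ) M} ∈
      residual (NonemptyCompacts ℝ) := by
  have h0 : IsMeagre ({0} : Set ℝ) := IsNowhereDense.isMeagre (by simp [IsNowhereDense])
  have hgen : ∀ᶠ C : NonemptyCompacts ℝ in residual (NonemptyCompacts ℝ),
      ∀ (n : ℕ) (c : Fin n → ℤ), c ≠ 0 → ∀ x : Fin n → ℝ, x.Injective → (∀ i, x i ∈ C) →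
        ∑ i, c i • x i ∉ M ∪ {0} :=
    eventually_countable_forall.2 fun n => eventually_countable_forall.2 fun c => by
      by_cases hc : c = 0
      · exact .of_forall fun C h => absurd hc h
      filter_upwards [eventually_residual_forall_injective_notMem
        (isMeagre_setOf_sum_mem hc (hMmeager.union h0))] with C hC _ using hC
  filter_upwards [hgen, eventually_residual_perfectSpace] with C hC hperf
  have hcomb (l : ↥(C : Set ℝ) →₀ ℤ) (hl : l ≠ 0) :
      Finsupp.linearCombination ℤ (Subtype.val : ↥(C : Set ℝ) → ℝ) l ∉ M ∪ {0} := by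
    obtain ⟨n, c, x, hc, hx, hxC, hsum⟩ := exists_fin_sum_eq_linearCombination hl
    exact hsum ▸ hC n c hc x hx hxC
  have hli : LinearIndependent ℚ (Subtype.val : ↥(C : Set ℝ) → ℝ) := by
    rw [← LinearIndependent.iff_fractionRing ℤ ℚ, linearIndependent_iff]
    intro l hl
    by_contra hne
    exact hcomb l hne (.inr hl)
  refine ⟨?_, hli, Set.disjoint_left.2 fun z hz hzM => ?_⟩
  · have := totallyDisconnectedSpace_subtype_iff.2 (isTotallyDisconnected_of_linearIndependent hli)
    have := isCompact_iff_compactSpace.1 C.isCompact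
    have := C.nonempty.to_subtype
    exact nonempty_homeomorph_nat_bool
  · rw [← Submodule.span_int_eq_addSubgroupClosure] at hz
    obtain ⟨l, rfl⟩ := (Finsupp.mem_span_iff_linearCombination ℤ (C : Set ℝ) z).1 hz
    refine hcomb l ?_ (.inl hzM)
    rintro rfl
    exact hM hzM (map_zero _)
end
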